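/- arXiv:2212.02993 — 2 statements merged into one kernel-verified Lean document; each statement's English description precedes it below -/
import Mathlib

section
/- Let H be a complex Hilbert space and let T be a bounded self-adjoint operator on H whose essential spectrum (the spectrum of the coset T + K(H) in the Calkin algebra L(H)/K(H)) is contained in [0,∞). Then there exists a compact operator K on H such that T + K is positive. -/
open Filter Topology

set_option linter.unusedSectionVars false

variable (H : Type*) [NormedAddCommGroup H] [InnerProductSpace ℂ H] [CompleteSpace H]

/-- The closed two-sided ideal of compact operators in `L(H)`. -/
noncomputable def compactIdeal : TwoSidedIdeal (H →L[ℂ] H) :=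
  TwoSidedIdeal.mk' {T : H →L[ℂ] H | IsCompactOperator ⇑T}
    isCompactOperator_zero
    (fun hx hy => hx.add hy)
    (fun hx => hx.neg)
    (fun {x y} hy => by
      have : IsCompactOperator (⇑x ∘ ⇑y) := hy.continuous_comp x.continuous
      simpa [Function.comp] using this)
    (fun {x y} hx => by
      have : IsCompactOperator (⇑x ∘ ⇑y) := hx.comp_clm y
      simpa [Function.comp] using this)

/-- The Calkin algebra `L(H)/K(H)`. -/
abbrev Calkin := (compactIdeal H).ringCon.Quotient

/-- The quotient map `L(H) → L(H)/K(H)`. -/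
noncomputable def calkinMk : (H →L[ℂ] H) →+* Calkin H := RingCon.mk' _

lemma calkinMk_surjective : Function.Surjective (calkinMk H) := fun x =>
  Quotient.inductionOn' x fun y => ⟨y, rfl⟩

noncomputable instance : Algebra ℂ (Calkin H) :=
  RingHom.toAlgebra' ((calkinMk H).comp (algebraMap ℂ (H →L[ℂ] H))) (by
    intro c x
    obtain ⟨y, rfl⟩ := calkinMk_surjective H x
    rw [RingHom.comp_apply, ← map_mul, ← map_mul, Algebra.commutes])

/-- An element of the Calkin algebra is positive if it is self-adjoint (equivalently, has a
self-adjoint representative) and its spectrum is contained in `[0, ∞)`. -/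
noncomputable def Calkin.IsPositive (x : Calkin H) : Prop :=
  (∃ S : H →L[ℂ] H, IsSelfAdjoint S ∧ calkinMk H S = x) ∧
    spectrum ℂ x ⊆ {z : ℂ | 0 ≤ z.re ∧ z.im = 0}

variable {H}

lemma calkinMk_eq_iff_compact (A B : H →L[ℂ] H) :
    calkinMk H A = calkinMk H B ↔ IsCompactOperator ⇑(A - B) := by
  have h1 : calkinMk H A = calkinMk H B ↔ (compactIdeal H).ringCon A B :=
    RingCon.eq _
  rw [h1, TwoSidedIdeal.rel_iff]
  exact TwoSidedIdeal.mem_mk' _ _ _ _ _ _ _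

/-- The ideal of continuous functions `g` on the spectrum with `g(T)` compact. -/
noncomputable def compactFunIdeal (T : H →L[ℂ] H) (hT : IsSelfAdjoint T) :
    Ideal C(spectrum ℝ T, ℝ) where
  carrier := {g | IsCompactOperator ⇑(cfcHom (R := ℝ) hT g)}
  zero_mem' := by
    simp only [Set.mem_setOf_eq, map_zero]
    exact isCompactOperator_zero
  add_mem' := by
    intro a b ha hb
    simp only [Set.mem_setOf_eq, map_add] at *
    exact ha.add hb
  smul_mem' := by
    intro c x hx
    simp only [Set.mem_setOf_eq, smul_eq_mul, map_mul] at *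
    exact hx.continuous_comp (cfcHom (R := ℝ) hT c).continuous

lemma mem_compactFunIdeal (T : H →L[ℂ] H) (hT : IsSelfAdjoint T) (g : C(spectrum ℝ T, ℝ)) :
    g ∈ compactFunIdeal T hT ↔ IsCompactOperator ⇑(cfcHom (R := ℝ) hT g) := Iff.rfl

lemma isClosed_compactFunIdeal (T : H →L[ℂ] H) (hT : IsSelfAdjoint T) :
    IsClosed (compactFunIdeal T hT : Set C(spectrum ℝ T, ℝ)) :=
  (isClosed_setOf_isCompactOperator (σ₁₂ := RingHom.id ℂ) (M₁ := H) (M₂ := H)).preimage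
    (cfcHom_continuous (R := ℝ) hT)

/-- Local step: near a point outside the essential spectrum, some `g(T)` is compact. -/
lemma exists_mem_compactFunIdeal (T : H →L[ℂ] H) (hT : IsSelfAdjoint T) (x : spectrum ℝ T)
    (hx : ((x : ℝ) : ℂ) ∉ spectrum ℂ (calkinMk H T)) :
    ∃ g ∈ compactFunIdeal T hT, g x ≠ 0 := by
  rw [spectrum.notMem_iff] at hx
  obtain ⟨s, hs⟩ := hx.exists_left_inv
  obtain ⟨S, rfl⟩ := calkinMk_surjective H s
  set A : H →L[ℂ] H := algebraMap ℂ (H →L[ℂ] H) ((x : ℝ) : ℂ) - T with hA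
  have hs' : calkinMk H (S * A) = calkinMk H 1 := by
    rw [map_mul, map_one, ← hs, hA, map_sub]
    rfl
  rw [calkinMk_eq_iff_compact] at hs'
  obtain ⟨δ, hδ, hδS⟩ : ∃ δ : ℝ, 0 < δ ∧ ‖S‖ * δ < 1 := by
    refine ⟨1 / (‖S‖ + 1), by positivity, ?_⟩
    rw [mul_one_div, div_lt_one (by positivity)]
    linarith
  let g : C(spectrum ℝ T, ℝ) := ⟨fun y => max 0 (δ - |(x : ℝ) - y|), by fun_prop⟩
  let c : C(spectrum ℝ T, ℝ) := ⟨fun y => max (-δ) (min δ ((x : ℝ) - y)), by fun_prop⟩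
  let a : C(spectrum ℝ T, ℝ) := ⟨fun y => (x : ℝ) - y, by fun_prop⟩
  have hca : a * g = c * g := by
    ext y
    simp only [a, g, c, ContinuousMap.mul_apply, ContinuousMap.coe_mk]
    rcases le_total |(x : ℝ) - y| δ with h | h
    · rw [abs_le] at h
      rw [min_eq_right h.2, max_eq_right h.1]
    · rw [max_eq_left (by linarith : δ - |(x : ℝ) - y| ≤ 0)]
      simp
  have haA : cfcHom (R := ℝ) hT a = A := by
    have : a = algebraMap ℝ C(spectrum ℝ T, ℝ) x - (ContinuousMap.id ℝ).restrict (spectrum ℝ T) := by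
      ext y
      simp [a]
    rw [this, map_sub, cfcHom_id, AlgHomClass.commutes, hA]
    congr 1
  have hcn : ‖cfcHom (R := ℝ) hT c‖ ≤ δ := by
    rw [norm_cfcHom (𝕜 := ℝ) T c hT, ContinuousMap.norm_le _ hδ.le]
    intro y
    rw [Real.norm_eq_abs, abs_le]
    exact ⟨le_max_left _ _, max_le (by linarith) (min_le_left _ _)⟩
  refine ⟨g, ?_, by simp [g, hδ.ne', hδ.le, hδ]⟩
  rw [mem_compactFunIdeal]
  set G := cfcHom (R := ℝ) hT g
  set C := cfcHom (R := ℝ) hT c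
  have hAG : A * G = C * G := by
    rw [← haA, ← map_mul, hca, map_mul]
  have hu : IsUnit (1 - S * C) := by
    apply isUnit_one_sub_of_norm_lt_one
    calc ‖S * C‖ ≤ ‖S‖ * ‖C‖ := norm_mul_le _ _
      _ ≤ ‖S‖ * δ := by gcongr
      _ < 1 := hδS
  obtain ⟨V, hV⟩ := hu.exists_left_inv
  have h1 : IsCompactOperator ⇑((S * A - 1) * G) := hs'.comp_clm G
  have h2 : (S * A - 1) * G = -((1 - S * C) * G) := by
    rw [sub_mul, mul_assoc, hAG]; noncomm_ring
  have h3 : G = -V * ((S * A - 1) * G) := by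
    rw [h2, neg_mul_neg, ← mul_assoc, hV, one_mul]
  rw [h3]
  exact h1.continuous_comp (-V).continuous

/-- If `T` is a bounded self-adjoint operator on a complex Hilbert space whose
essential spectrum (the spectrum of the coset `T + K(H)` in the Calkin algebra) is contained in
`[0, ∞)`, then there exists a compact operator `K` such that `T + K` is positive. -/
theorem exists_compact_positive_of_essSpectrum_subset_nonneg
    (T : H →L[ℂ] H) (hT : IsSelfAdjoint T)
    (h : spectrum ℂ (calkinMk H T) ⊆ {z : ℂ | 0 ≤ z.re ∧ z.im = 0}) :
    ∃ K : H →L[ℂ] H, IsCompactOperator ⇑K ∧ (T + K).IsPositive := by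
  let n : C(spectrum ℝ T, ℝ) := ⟨fun y => max 0 (-(y : ℝ)), by fun_prop⟩
  have hn : n ∈ compactFunIdeal T hT := by
    have hcl : (compactFunIdeal T hT).closure = compactFunIdeal T hT :=
      Ideal.closure_eq_of_isClosed _ (isClosed_compactFunIdeal T hT)
    rw [← hcl, ← ContinuousMap.idealOfSet_ofIdeal_eq_closure, ContinuousMap.mem_idealOfSet]
    intro x hx
    rw [Set.mem_compl_iff, ContinuousMap.mem_setOfIdeal] at hx
    by_contra hne
    apply hx
    apply exists_mem_compactFunIdeal
    intro hmem
    have h0 : 0 ≤ (x : ℝ) := by simpa using (h hmem).1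
    exact hne (max_eq_left (by linarith))
  refine ⟨cfcHom (R := ℝ) hT n, hn, ?_⟩
  rw [← ContinuousLinearMap.nonneg_iff_isPositive]
  have : T + cfcHom (R := ℝ) hT n =
      cfcHom (R := ℝ) hT ((ContinuousMap.id ℝ).restrict (spectrum ℝ T) + n) := by
    rw [map_add, cfcHom_id]
  rw [this, cfcHom_nonneg_iff]
  intro y
  have := le_max_right 0 (-(y : ℝ))
  change (0 : ℝ) ≤ (y : ℝ) + max 0 (-(y : ℝ))
  linarith
end

section
/- Let (a_n)_{n≥0} be a sequence of real numbers such that the power series Σ_{n=0}^∞ a_n x^n converges for all |x| < 1, and suppose there is a constant C with a_n ≥ −C for all n. If (1 − x) Σ_{n=0}^∞ a_n x^n → a as x → 1⁻, then (a_0 + a_1 + ⋯ + a_n)/(n + 1) → a as n → ∞. -/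
open Filter Topology

/-- The Abel-type functional used in Karamata's argument. -/
noncomputable def karPhi (b : ℕ → ℝ) (f : ℝ → ℝ) (x : ℝ) : ℝ :=
  (1 - x) * ∑' n : ℕ, b n * x ^ n * f (x ^ n)

lemma kar_pow_mem {x : ℝ} (hx : x ∈ Set.Ioo (0 : ℝ) 1) (n : ℕ) : x ^ n ∈ Set.Icc (0 : ℝ) 1 :=
  ⟨pow_nonneg hx.1.le n, pow_le_one₀ hx.1.le hx.2.le⟩

lemma kar_summable (b : ℕ → ℝ) (hb : ∀ n, 0 ≤ b n)
    (hs : ∀ x ∈ Set.Ioo (0 : ℝ) 1, Summable (fun n => b n * x ^ n))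
    (f : ℝ → ℝ) (hf : Continuous f) {x : ℝ} (hx : x ∈ Set.Ioo (0 : ℝ) 1) :
    Summable (fun n => b n * x ^ n * f (x ^ n)) := by
  obtain ⟨M, hM⟩ := (isCompact_Icc (a := (0 : ℝ)) (b := 1)).exists_bound_of_continuousOn
    hf.continuousOn
  refine Summable.of_norm_bounded ((hs x hx).mul_right M) fun n => ?_
  rw [norm_mul, Real.norm_of_nonneg (mul_nonneg (hb n) (pow_nonneg hx.1.le n))]
  exact mul_le_mul_of_nonneg_left (hM _ (kar_pow_mem hx n))
    (mul_nonneg (hb n) (pow_nonneg hx.1.le n))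

lemma kar_poly (b : ℕ → ℝ) (hb : ∀ n, 0 ≤ b n)
    (hs : ∀ x ∈ Set.Ioo (0 : ℝ) 1, Summable (fun n => b n * x ^ n)) (B : ℝ)
    (h : Tendsto (fun x : ℝ => (1 - x) * ∑' n : ℕ, b n * x ^ n)
      (𝓝[Set.Ioo (0 : ℝ) 1] 1) (𝓝 B)) (p : Polynomial ℝ) :
    Tendsto (karPhi b (fun t => p.eval t)) (𝓝[Set.Ioo (0 : ℝ) 1] 1)
      (𝓝 (B * ∫ t in (0 : ℝ)..1, p.eval t)) := by
  induction p using Polynomial.induction_on' with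
  | add p q hp hq =>
    have h1 : B * ∫ t in (0 : ℝ)..1, (p + q).eval t
        = B * (∫ t in (0 : ℝ)..1, p.eval t) + B * ∫ t in (0 : ℝ)..1, q.eval t := by
      simp only [Polynomial.eval_add]
      rw [intervalIntegral.integral_add (p.continuous.intervalIntegrable _ _)
        (q.continuous.intervalIntegrable _ _), mul_add]
    rw [h1]
    refine (hp.add hq).congr' ?_
    filter_upwards [self_mem_nhdsWithin] with x hx
    simp only [karPhi, Polynomial.eval_add, mul_add]
    rw [(kar_summable b hb hs _ p.continuous hx).tsum_add
      (kar_summable b hb hs _ q.continuous hx)]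
    ring
  | monomial k c =>
    have hpow : Tendsto (fun x : ℝ => x ^ (k + 1)) (𝓝[Set.Ioo (0 : ℝ) 1] 1)
        (𝓝[Set.Ioo (0 : ℝ) 1] 1) := by
      refine tendsto_nhdsWithin_iff.2 ⟨?_, ?_⟩
      · have : Tendsto (fun x : ℝ => x ^ (k + 1)) (𝓝 1) (𝓝 (1 ^ (k + 1))) :=
          (continuous_pow (k + 1)).tendsto 1
        rw [one_pow] at this
        exact this.mono_left nhdsWithin_le_nhds
      · filter_upwards [self_mem_nhdsWithin] with x hx
        exact ⟨pow_pos hx.1 _, pow_lt_one₀ hx.1.le hx.2 (by omega)⟩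
    have hg : Tendsto (fun x : ℝ => (∑ i ∈ Finset.range (k + 1), x ^ i)⁻¹)
        (𝓝[Set.Ioo (0 : ℝ) 1] 1) (𝓝 ((k : ℝ) + 1)⁻¹) := by
      have : Tendsto (fun x : ℝ => ∑ i ∈ Finset.range (k + 1), x ^ i) (𝓝 1)
          (𝓝 (∑ i ∈ Finset.range (k + 1), (1 : ℝ) ^ i)) :=
        Continuous.tendsto (by fun_prop) 1
      simp only [one_pow, Finset.sum_const, Finset.card_range, nsmul_eq_mul, mul_one,
        Nat.cast_add, Nat.cast_one] at this
      exact (this.mono_left nhdsWithin_le_nhds).inv₀ (by positivity)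
    have h1 : B * ∫ t in (0 : ℝ)..1, (Polynomial.monomial k c).eval t
        = c * (((k : ℝ) + 1)⁻¹ * B) := by
      simp only [Polynomial.eval_monomial]
      rw [intervalIntegral.integral_const_mul, integral_pow]
      simp
      ring
    rw [h1]
    refine ((hg.mul (h.comp hpow)).const_mul c).congr' ?_
    filter_upwards [self_mem_nhdsWithin] with x hx
    simp only [karPhi, Polynomial.eval_monomial, Function.comp]
    have h2 : ∀ n, b n * x ^ n * (c * (x ^ n) ^ k) = c * (b n * (x ^ (k + 1)) ^ n) := by
      intro n
      rw [← pow_mul, ← pow_mul, add_mul, pow_add, one_mul, mul_comm n k]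
      ring
    simp only [h2]
    rw [tsum_mul_left]
    have h3 : 1 - x ^ (k + 1) = (∑ i ∈ Finset.range (k + 1), x ^ i) * (1 - x) :=
      (geom_sum_mul_neg x (k + 1)).symm
    have h4 : 0 < ∑ i ∈ Finset.range (k + 1), x ^ i :=
      Finset.sum_pos (fun i _ => pow_pos hx.1 i) (by simp)
    rw [h3]
    field_simp

lemma kar_cont (b : ℕ → ℝ) (hb : ∀ n, 0 ≤ b n)
    (hs : ∀ x ∈ Set.Ioo (0 : ℝ) 1, Summable (fun n => b n * x ^ n)) (B : ℝ) (hB : 0 ≤ B)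
    (h : Tendsto (fun x : ℝ => (1 - x) * ∑' n : ℕ, b n * x ^ n)
      (𝓝[Set.Ioo (0 : ℝ) 1] 1) (𝓝 B)) (f : ℝ → ℝ) (hf : Continuous f) :
    Tendsto (karPhi b f) (𝓝[Set.Ioo (0 : ℝ) 1] 1)
      (𝓝 (B * ∫ t in (0 : ℝ)..1, f t)) := by
  rw [Metric.tendsto_nhds]
  intro η hη
  set ε := η / (2 * B + 2) with hε
  have hεp : 0 < ε := by positivity
  obtain ⟨p, hp⟩ := exists_polynomial_near_of_continuousOn 0 1 f hf.continuousOn ε hεp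
  have h1 := (Metric.tendsto_nhds.1 (kar_poly b hb hs B h p)) ε hεp
  have h2 := h.eventually (gt_mem_nhds (show B < B + 1 by linarith))
  filter_upwards [h1, h2, self_mem_nhdsWithin] with x hx1 hx2 hx
  have hsf := kar_summable b hb hs f hf hx
  have hsp := kar_summable b hb hs _ p.continuous hx
  have h3 : |karPhi b f x - karPhi b (fun t => p.eval t) x|
      ≤ ε * ((1 - x) * ∑' n : ℕ, b n * x ^ n) := by
    simp only [karPhi]
    rw [← mul_sub, ← hsf.tsum_sub hsp, abs_mul, abs_of_pos (sub_pos.2 hx.2), mul_left_comm,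
      ← tsum_mul_left]
    refine mul_le_mul_of_nonneg_left ?_ (sub_pos.2 hx.2).le
    have := tsum_of_norm_bounded (((hs x hx).mul_left ε).hasSum)
      (f := fun n => b n * x ^ n * f (x ^ n) - b n * x ^ n * p.eval (x ^ n)) (fun n => by
        rw [← mul_sub, norm_mul, Real.norm_of_nonneg (mul_nonneg (hb n) (pow_nonneg hx.1.le n)),
          mul_comm ε, Real.norm_eq_abs, abs_sub_comm]
        exact mul_le_mul_of_nonneg_left (hp _ (kar_pow_mem hx n)).le
          (mul_nonneg (hb n) (pow_nonneg hx.1.le n)))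
    simpa using this
  have h4 : |(∫ t in (0 : ℝ)..1, p.eval t) - ∫ t in (0 : ℝ)..1, f t| ≤ ε := by
    rw [← intervalIntegral.integral_sub (p.continuous.intervalIntegrable _ _)
      (hf.intervalIntegrable _ _)]
    have := intervalIntegral.norm_integral_le_of_norm_le_const (a := (0 : ℝ)) (b := 1)
      (f := fun t => p.eval t - f t) (C := ε) (fun t ht => by
        rw [Set.uIoc_of_le zero_le_one] at ht
        exact (hp t ⟨ht.1.le, ht.2⟩).le)
    simpa using this
  rw [Real.dist_eq] at hx1 ⊢
  have h5 : |B * (∫ t in (0 : ℝ)..1, p.eval t) - B * ∫ t in (0 : ℝ)..1, f t| ≤ B * ε := by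
    rw [← mul_sub, abs_mul, abs_of_nonneg hB]
    exact mul_le_mul_of_nonneg_left h4 hB
  have h6 : ε * ((1 - x) * ∑' n : ℕ, b n * x ^ n) < ε * (B + 1) :=
    mul_lt_mul_of_pos_left hx2 hεp
  have h7 : ε * (2 * B + 2) = η := by rw [hε]; field_simp
  rw [abs_lt] at hx1 ⊢
  rw [abs_le] at h3 h5
  constructor <;> nlinarith

/-- The continuous cut-off of `1 / t`. -/
noncomputable def karF (u v t : ℝ) : ℝ := min 1 (max 0 ((t - u) / (v - u))) / max t u

lemma karF_cont {u v : ℝ} (hu : 0 < u) : Continuous (karF u v) := by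
  unfold karF
  refine Continuous.div (by fun_prop) (by fun_prop) fun t => ?_
  exact (lt_of_lt_of_le hu (le_max_right _ _)).ne'

lemma karF_nonneg {u v : ℝ} (hu : 0 < u) (t : ℝ) : 0 ≤ karF u v t := by
  unfold karF
  have := lt_of_lt_of_le hu (le_max_right t u)
  positivity

lemma karF_zero {u v t : ℝ} (huv : u < v) (ht : t ≤ u) : karF u v t = 0 := by
  unfold karF
  rw [max_eq_left (div_nonpos_of_nonpos_of_nonneg (by linarith) (by linarith))]
  simp

lemma karF_le {u v t : ℝ} (hu : 0 < u) (ht : 0 < t) : karF u v t ≤ t⁻¹ := by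
  unfold karF
  rw [← one_div]
  gcongr
  · exact min_le_left _ _
  · exact le_max_left _ _

lemma karF_eq {u v t : ℝ} (huv : u < v) (ht : v ≤ t) : karF u v t = t⁻¹ := by
  unfold karF
  have h1 : 1 ≤ (t - u) / (v - u) := by
    rw [le_div_iff₀ (by linarith)]; linarith
  rw [min_eq_left (h1.trans (le_max_right _ _)), max_eq_left (by linarith), one_div]

lemma karF_int_le {u v : ℝ} (hu : 0 < u) (huv : u < v) (hu1 : u ≤ 1) :
    ∫ t in (0 : ℝ)..1, karF u v t ≤ - Real.log u := by
  have hc := karF_cont (v := v) hu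
  rw [← intervalIntegral.integral_add_adjacent_intervals (hc.intervalIntegrable 0 u)
    (hc.intervalIntegrable u 1)]
  have h1 : ∫ t in (0 : ℝ)..u, karF u v t = 0 := by
    rw [intervalIntegral.integral_congr (g := fun _ => (0 : ℝ))]
    · simp
    · intro t ht
      rw [Set.uIcc_of_le hu.le] at ht
      exact karF_zero huv ht.2
  have h0 : (0 : ℝ) ∉ Set.uIcc u 1 := by
    rw [Set.uIcc_of_le hu1]; intro h; linarith [h.1]
  have h2 : ∫ t in u..1, karF u v t ≤ ∫ t in u..1, t⁻¹ := by
    refine intervalIntegral.integral_mono_on hu1 (hc.intervalIntegrable _ _) ?_ ?_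
    · exact intervalIntegral.intervalIntegrable_inv (fun t ht h => h0 (h ▸ ht)) continuousOn_id
    · intro t ht
      exact karF_le hu (by linarith [ht.1])
  rw [integral_inv h0] at h2
  rw [h1, zero_add]
  simpa using h2

lemma karF_int_ge {u v : ℝ} (hu : 0 < u) (huv : u < v) (hv1 : v ≤ 1) :
    - Real.log v ≤ ∫ t in (0 : ℝ)..1, karF u v t := by
  have hc := karF_cont (v := v) hu
  rw [← intervalIntegral.integral_add_adjacent_intervals (hc.intervalIntegrable 0 v)
    (hc.intervalIntegrable v 1)]
  have h1 : 0 ≤ ∫ t in (0 : ℝ)..v, karF u v t :=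
    intervalIntegral.integral_nonneg (by linarith) fun t _ => karF_nonneg hu t
  have h0 : (0 : ℝ) ∉ Set.uIcc v 1 := by
    rw [Set.uIcc_of_le hv1]; intro h; linarith [h.1]
  have h2 : ∫ t in v..1, karF u v t = ∫ t in v..1, t⁻¹ := by
    refine intervalIntegral.integral_congr fun t ht => ?_
    rw [Set.uIcc_of_le hv1] at ht
    exact karF_eq huv ht.1
  rw [integral_inv h0] at h2
  rw [h2]
  simp only [one_div, Real.log_inv]
  linarith

/-- The sample points. -/
noncomputable def karX (n : ℕ) : ℝ := Real.exp (-((n : ℝ) + 1)⁻¹)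

lemma karX_mem (n : ℕ) : karX n ∈ Set.Ioo (0 : ℝ) 1 := by
  refine ⟨Real.exp_pos _, ?_⟩
  unfold karX
  rw [Real.exp_lt_one_iff]
  have : (0 : ℝ) < ((n : ℝ) + 1)⁻¹ := by positivity
  linarith

lemma kar_inv_tendsto : Tendsto (fun n : ℕ => ((n : ℝ) + 1)⁻¹) atTop (𝓝 0) := by
  simpa [one_div] using tendsto_one_div_add_atTop_nhds_zero_nat (𝕜 := ℝ)

lemma karX_tendsto : Tendsto karX atTop (𝓝[Set.Ioo (0 : ℝ) 1] 1) := by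
  refine tendsto_nhdsWithin_iff.2 ⟨?_, Eventually.of_forall karX_mem⟩
  have := (Real.continuous_exp.tendsto _).comp kar_inv_tendsto.neg
  rw [neg_zero, Real.exp_zero] at this
  exact this

lemma karX_pow (n k : ℕ) : karX n ^ k = Real.exp (-((k : ℝ) / (n + 1))) := by
  unfold karX
  rw [← Real.exp_nat_mul]
  congr 1
  ring

lemma karX_ge {n k : ℕ} (hk : k < n + 1) : Real.exp (-1) ≤ karX n ^ k := by
  rw [karX_pow, Real.exp_le_exp, neg_le_neg_iff, div_le_one (by positivity)]
  exact_mod_cast hk.le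

lemma karX_le {n k : ℕ} (hk : n + 1 ≤ k) : karX n ^ k ≤ Real.exp (-1) := by
  rw [karX_pow, Real.exp_le_exp, neg_le_neg_iff, le_div_iff₀ (by positivity)]
  rw [one_mul]
  exact_mod_cast hk

lemma karX_scale : Tendsto (fun n : ℕ => ((n : ℝ) + 1) * (1 - karX n)) atTop (𝓝 1) := by
  have h1 : HasDerivAt (fun y : ℝ => 1 - Real.exp (-y)) 1 0 := by
    have := ((hasDerivAt_neg (0 : ℝ)).exp).const_sub 1
    simpa using this
  have h2 := h1.tendsto_slope_zero
  have h3 : Tendsto (fun n : ℕ => ((n : ℝ) + 1)⁻¹) atTop (𝓝[≠] 0) :=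
    tendsto_nhdsWithin_iff.2 ⟨kar_inv_tendsto, Eventually.of_forall fun n => by
      simp only [Set.mem_compl_iff, Set.mem_singleton_iff]; positivity⟩
  have h4 := h2.comp h3
  simpa [Function.comp_def, karX] using h4

lemma kar_main (b : ℕ → ℝ) (hb : ∀ n, 0 ≤ b n)
    (hs : ∀ x ∈ Set.Ioo (0 : ℝ) 1, Summable (fun n => b n * x ^ n)) (B : ℝ)
    (h : Tendsto (fun x : ℝ => (1 - x) * ∑' n : ℕ, b n * x ^ n)
      (𝓝[Set.Ioo (0 : ℝ) 1] 1) (𝓝 B)) :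
    Tendsto (fun n : ℕ => (∑ k ∈ Finset.range (n + 1), b k) / (n + 1)) atTop (𝓝 B) := by
  have hB : 0 ≤ B := by
    refine ge_of_tendsto' (h.comp karX_tendsto) fun n => ?_
    have hx := karX_mem n
    exact mul_nonneg (sub_pos.2 hx.2).le
      (tsum_nonneg fun k => mul_nonneg (hb k) (pow_nonneg hx.1.le k))
  have hup : ∀ n u, 0 < u → u < Real.exp (-1) →
      (1 - karX n) * ∑ k ∈ Finset.range (n + 1), b k
        ≤ karPhi b (karF u (Real.exp (-1))) (karX n) := by
    intro n u hu huv
    have hx := karX_mem n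
    refine mul_le_mul_of_nonneg_left ?_ (sub_pos.2 hx.2).le
    have hsum := kar_summable b hb hs _ (karF_cont (v := Real.exp (-1)) hu) hx
    refine le_trans (le_of_eq ?_) (hsum.sum_le_tsum (Finset.range (n + 1)) fun k _ =>
      mul_nonneg (mul_nonneg (hb k) (pow_nonneg hx.1.le k)) (karF_nonneg hu _))
    refine Finset.sum_congr rfl fun k hk => ?_
    rw [karF_eq huv (karX_ge (Finset.mem_range.1 hk)), mul_assoc,
      mul_inv_cancel₀ (pow_pos hx.1 k).ne', mul_one]
  have hlo : ∀ n v, Real.exp (-1) < v →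
      karPhi b (karF (Real.exp (-1)) v) (karX n)
        ≤ (1 - karX n) * ∑ k ∈ Finset.range (n + 1), b k := by
    intro n v huv
    have hx := karX_mem n
    refine mul_le_mul_of_nonneg_left ?_ (sub_pos.2 hx.2).le
    rw [tsum_eq_sum (s := Finset.range (n + 1))]
    · refine Finset.sum_le_sum fun k _ => ?_
      have hp := pow_pos hx.1 k
      calc b k * karX n ^ k * karF (Real.exp (-1)) v (karX n ^ k)
          ≤ b k * karX n ^ k * (karX n ^ k)⁻¹ :=
            mul_le_mul_of_nonneg_left (karF_le (Real.exp_pos _) hp) (mul_nonneg (hb k) hp.le)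
        _ = b k := by rw [mul_assoc, mul_inv_cancel₀ hp.ne', mul_one]
    · intro k hk
      rw [Finset.mem_range, not_lt] at hk
      rw [karF_zero huv (karX_le hk), mul_zero]
  have hT : Tendsto (fun n : ℕ => (1 - karX n) * ∑ k ∈ Finset.range (n + 1), b k)
      atTop (𝓝 B) := by
    refine tendsto_order.2 ⟨fun c hc => ?_, fun c hc => ?_⟩
    · obtain ⟨δ, hδ0, hδ1, hδ⟩ : ∃ δ : ℝ, 0 < δ ∧ δ ≤ 1 ∧ c < B * (1 - δ) := by
        refine ⟨min 1 ((B - c) / (2 * (B + 1))), ?_, min_le_left _ _, ?_⟩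
        · have : 0 < B - c := by linarith
          positivity
        · have h1 : min 1 ((B - c) / (2 * (B + 1))) * (2 * (B + 1)) ≤ B - c := by
            rw [← le_div_iff₀ (by positivity)]; exact min_le_right _ _
          have h2 : 0 < min 1 ((B - c) / (2 * (B + 1))) := by
            have : 0 < B - c := by linarith
            positivity
          nlinarith
      have huv : Real.exp (-1) < Real.exp (-1 + δ) := Real.exp_lt_exp.2 (by linarith)
      have h1 := (kar_cont b hb hs B hB h _ (karF_cont (v := Real.exp (-1 + δ))
        (Real.exp_pos (-1)))).comp karX_tendsto
      have h2 := karF_int_ge (Real.exp_pos (-1)) huv (Real.exp_le_one_iff.2 (by linarith))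
      rw [Real.log_exp] at h2
      have h3 := mul_le_mul_of_nonneg_left h2 hB
      filter_upwards [h1.eventually (lt_mem_nhds (show c < _ by linarith))] with n hn
      exact lt_of_lt_of_le hn (hlo n _ huv)
    · obtain ⟨δ, hδ0, hδ⟩ : ∃ δ : ℝ, 0 < δ ∧ B * (1 + δ) < c := by
        have hp : 0 < c - B := by linarith
        refine ⟨(c - B) / (2 * (B + 1)), by positivity, ?_⟩
        have h1 : (c - B) / (2 * (B + 1)) * (2 * (B + 1)) = c - B := by field_simp
        have h2 : 0 < (c - B) / (2 * (B + 1)) := by positivity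
        nlinarith
      have huv : Real.exp (-1 - δ) < Real.exp (-1) := Real.exp_lt_exp.2 (by linarith)
      have h1 := (kar_cont b hb hs B hB h _ (karF_cont (v := Real.exp (-1))
        (Real.exp_pos (-1 - δ)))).comp karX_tendsto
      have h2 := karF_int_le (Real.exp_pos (-1 - δ)) huv (Real.exp_le_one_iff.2 (by linarith))
      rw [Real.log_exp] at h2
      have h3 := mul_le_mul_of_nonneg_left h2 hB
      filter_upwards [h1.eventually (gt_mem_nhds (show _ < c by linarith))] with n hn
      exact lt_of_le_of_lt (hup n _ (Real.exp_pos _) huv) hn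
  have h5 := hT.div karX_scale one_ne_zero
  rw [div_one] at h5
  refine h5.congr fun n => ?_
  have hx : 1 - karX n ≠ 0 := (sub_pos.2 (karX_mem n).2).ne'
  have hn : (n : ℝ) + 1 ≠ 0 := by positivity
  simp only [Pi.div_apply]
  field_simp

/-- Tauberian theorem. If `∑ aₙ xⁿ` converges for `|x| < 1`, the `aₙ` are
bounded below by `-C`, and `(1 - x) ∑ aₙ xⁿ → a` as `x → 1⁻`, then the Cesàro means
`(a₀ + ⋯ + aₙ)/(n + 1)` converge to `a`. -/
theorem cesaro_tendsto_of_abel_tendsto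
    (a : ℕ → ℝ) (hconv : ∀ x : ℝ, |x| < 1 → Summable (fun n => a n * x ^ n))
    (C : ℝ) (hC : ∀ n, -C ≤ a n) (A : ℝ)
    (habel : Tendsto (fun x : ℝ => (1 - x) * ∑' n : ℕ, a n * x ^ n)
      (𝓝[Set.Ioo (0 : ℝ) 1] 1) (𝓝 A)) :
    Tendsto (fun n : ℕ => (∑ k ∈ Finset.range (n + 1), a k) / (n + 1)) atTop (𝓝 A) := by
  have hsa : ∀ x ∈ Set.Ioo (0 : ℝ) 1, Summable (fun n => a n * x ^ n) := fun x hx =>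
    hconv x (by rw [abs_of_pos hx.1]; exact hx.2)
  have hsc : ∀ x ∈ Set.Ioo (0 : ℝ) 1, Summable (fun n : ℕ => C * x ^ n) := fun x hx =>
    (summable_geometric_of_lt_one hx.1.le hx.2).mul_left C
  have key := kar_main (fun n => a n + C) (fun n => by linarith [hC n])
    (fun x hx => by simpa only [add_mul] using (hsa x hx).add (hsc x hx)) (A + C) (by
      refine (habel.add_const C).congr' ?_
      filter_upwards [self_mem_nhdsWithin] with x hx
      simp only [add_mul]
      rw [(hsa x hx).tsum_add (hsc x hx), tsum_mul_left,
        tsum_geometric_of_lt_one hx.1.le hx.2]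
      have : 1 - x ≠ 0 := (sub_pos.2 hx.2).ne'
      field_simp)
  have h2 := key.sub_const C
  rw [add_sub_cancel_right] at h2
  refine h2.congr fun n => ?_
  have hn : (n : ℝ) + 1 ≠ 0 := by positivity
  simp only [Finset.sum_add_distrib, Finset.sum_const, Finset.card_range, nsmul_eq_mul,
    Nat.cast_add, Nat.cast_one]
  field_simp
  ring
end
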